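/- For every x ≥ 0 and ε > 0, if T_a^{(x),+} < τ_0^{(x),−}, then L^{(x+ε)}(t) − L^{(x)}(t) = 0 for all t ∈ [0, T_a^{(x+ε),+}), L^{(x+ε)}(t) − L^{(x)}(t) = ε for all t ∈ [T_a^{(x),+}, ∞), and R^{(x+ε)}(t) = R^{(x)}(t) for all t ∈ [0, ∞). -/

import Mathlib

open Filter Set

/-- A càdlàg function: right-continuous with left limits. -/
def CadlagFun (f : ℝ → ℝ) : Prop :=
  (∀ t : ℝ, ContinuousWithinAt f (Set.Ici t) t) ∧
  (∀ t : ℝ, ∃ l : ℝ, Tendsto f (nhdsWithin t (Set.Iio t)) (nhds l))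

/-- A strictly increasing sequence of times starting at `0` and tending to `∞`. -/
def IsTimeGrid (T : ℕ → ℝ) : Prop :=
  T 0 = 0 ∧ StrictMono T ∧ Tendsto T atTop atTop

/-- The periodic-classical reflected triple `(U, L, R)` of the path `t ↦ y + f t`:
classical reflection below at level `0`, periodic reflection above at level `a` at the
times `T k`, defined by the recursive specification. -/
structure IsPCTriple (a : ℝ) (T : ℕ → ℝ) (f : ℝ → ℝ) (y : ℝ)
    (U L R : ℝ → ℝ) : Prop where
  L_first : ∀ t : ℝ, 0 ≤ t → t < T 1 → L t = 0
  R_first : ∀ t : ℝ, 0 ≤ t → t < T 1 →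
    R t = max 0 (-sInf ((fun s => y + f s) '' Set.Icc 0 t))
  U_first : ∀ t : ℝ, 0 ≤ t → t < T 1 → U t = y + f t + R t
  R_seg : ∀ (k : ℕ) (t : ℝ), T k < t → t < T (k + 1) →
    R t = R (T k) + max 0 (-sInf ((fun s => U (T k) + f s - f (T k)) '' Set.Icc (T k) t))
  U_seg : ∀ (k : ℕ) (t : ℝ), T k < t → t < T (k + 1) →
    U t = (U (T k) + f t - f (T k)) + (R t - R (T k))
  L_seg : ∀ (k : ℕ) (t : ℝ), T k < t → t < T (k + 1) → L t = L (T k)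
  R_jump : ∀ k : ℕ, R (T (k + 1)) = R (T k) +
    max 0 (-sInf ((fun s => U (T k) + f s - f (T k)) '' Set.Icc (T k) (T (k + 1))))
  L_jump : ∀ k : ℕ, L (T (k + 1)) = L (T k) +
    max (((U (T k) + f (T (k + 1)) - f (T k)) + (R (T (k + 1)) - R (T k))) - a) 0
  U_jump : ∀ k : ℕ, U (T (k + 1)) =
    min ((U (T k) + f (T (k + 1)) - f (T k)) + (R (T (k + 1)) - R (T k))) a

/-- `τ_0^{(y),-} = inf {t ≥ 0 : y + f t < 0}`, with `inf ∅ = +∞`, as an extended real. -/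
noncomputable def tauMinus (f : ℝ → ℝ) (y : ℝ) : EReal :=
  sInf ((fun t : ℝ => (t : EReal)) '' {t : ℝ | 0 ≤ t ∧ y + f t < 0})

/-- `T_a^{(y),+} = inf {T k : k ≥ 1, y + f (T k) > a}`, with `inf ∅ = +∞`. -/
noncomputable def TPlus (a : ℝ) (T : ℕ → ℝ) (f : ℝ → ℝ) (y : ℝ) : EReal :=
  sInf ((fun t : ℝ => (t : EReal)) ''
    {t : ℝ | ∃ k : ℕ, 1 ≤ k ∧ t = T k ∧ a < y + f (T k)})

/-- Every nonnegative time lies in a half-open cell of the grid. -/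
lemma IsTimeGrid.exists_cell {T : ℕ → ℝ} (hT : IsTimeGrid T) {t : ℝ} (ht : 0 ≤ t) :
    ∃ k : ℕ, T k ≤ t ∧ t < T (k + 1) := by
  classical
  have hex : ∃ n : ℕ, t < T n := (hT.2.2.eventually_gt_atTop t).exists
  obtain ⟨k, hk⟩ : ∃ k, Nat.find hex = k + 1 := by
    refine Nat.exists_eq_succ_of_ne_zero fun h => ?_
    have := Nat.find_spec hex
    rw [h, hT.1] at this
    linarith
  refine ⟨k, not_lt.mp (Nat.find_min hex (by omega)), ?_⟩
  rw [← hk]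
  exact Nat.find_spec hex

lemma IsTimeGrid.nonneg {T : ℕ → ℝ} (hT : IsTimeGrid T) (k : ℕ) : 0 ≤ T k :=
  hT.1 ▸ hT.2.1.monotone (Nat.zero_le k)

lemma max_zero_neg_sInf_image_eq_zero {g : ℝ → ℝ} {s : Set ℝ} (h : ∀ u ∈ s, 0 ≤ g u) :
    max 0 (-sInf (g '' s)) = 0 := by
  refine max_eq_left (neg_nonpos.mpr (Real.sInf_nonneg ?_))
  rintro _ ⟨u, hu, rfl⟩
  exact h u hu

namespace IsPCTriple

variable {a : ℝ} {T : ℕ → ℝ} {f : ℝ → ℝ} {x y : ℝ} {U L R U' L' R' : ℝ → ℝ}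

lemma L_eq_of_mem_cell (h : IsPCTriple a T f y U L R) {k : ℕ} {t : ℝ} (h1 : T k ≤ t)
    (h2 : t < T (k + 1)) : L t = L (T k) := by
  rcases h1.eq_or_lt with rfl | h1
  · rfl
  · exact h.L_seg k t h1 h2

/-- As long as `x + f` is nonnegative and does not exceed `a` at the grid times, the triple
started from `y ≥ x` has no reflection at `0`, and its upper reflection is at most `y - x`. -/
lemma state_before_crossing (h : IsPCTriple a T f y U L R) (hT : IsTimeGrid T) (hxy : x ≤ y)
    {k : ℕ} (hpos : ∀ s, 0 ≤ s → s ≤ T k → 0 ≤ x + f s)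
    (hle : ∀ j, 1 ≤ j → j ≤ k → x + f (T j) ≤ a) :
    R (T k) = 0 ∧ U (T k) = y + f (T k) - L (T k) ∧ 0 ≤ L (T k) ∧ L (T k) ≤ y - x := by
  induction k with
  | zero =>
    have hT1 : T 0 < T 1 := hT.2.1 one_pos
    have hx0 := hpos (T 0) hT.1.ge le_rfl
    rw [hT.1] at hT1 hx0 ⊢
    have hL := h.L_first 0 le_rfl hT1
    have hR : R 0 = 0 := by
      rw [h.R_first 0 le_rfl hT1]
      refine max_zero_neg_sInf_image_eq_zero fun u hu => ?_
      obtain rfl : u = 0 := le_antisymm hu.2 hu.1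
      linarith
    have hU := h.U_first 0 le_rfl hT1
    refine ⟨hR, ?_, ?_, ?_⟩ <;> linarith
  | succ k ih =>
    have hlt : T k < T (k + 1) := hT.2.1 k.lt_succ_self
    obtain ⟨hR, hU, hL0, hL1⟩ := ih (fun s h0 h1 => hpos s h0 (h1.trans hlt.le))
      (fun j h1 h2 => hle j h1 (h2.trans k.le_succ))
    have hRs := h.R_jump k
    rw [max_zero_neg_sInf_image_eq_zero (fun u hu => by
      have := hpos u ((hT.nonneg k).trans hu.1) hu.2
      linarith)] at hRs
    have hLs := h.L_jump k
    have hUs := h.U_jump k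
    have hx := hle (k + 1) (by omega) le_rfl
    rcases le_total ((U (T k) + f (T (k + 1)) - f (T k)) + (R (T (k + 1)) - R (T k))) a
      with hc | hc
    · rw [max_eq_right (by linarith)] at hLs
      rw [min_eq_left hc] at hUs
      refine ⟨?_, ?_, ?_, ?_⟩ <;> linarith
    · rw [max_eq_left (by linarith)] at hLs
      rw [min_eq_right hc] at hUs
      refine ⟨?_, ?_, ?_, ?_⟩ <;> linarith

/-- If moreover `x + f` exceeds `a` at the next grid time, then the triple started from `y ≥ x`
is reset to level `a` there. -/
lemma state_at_crossing (h : IsPCTriple a T f y U L R) (hT : IsTimeGrid T) (hxy : x ≤ y)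
    {k : ℕ} (hpos : ∀ s, 0 ≤ s → s ≤ T (k + 1) → 0 ≤ x + f s)
    (hle : ∀ j, 1 ≤ j → j ≤ k → x + f (T j) ≤ a) (hgt : a < x + f (T (k + 1))) :
    R (T (k + 1)) = 0 ∧ U (T (k + 1)) = a ∧ L (T (k + 1)) = y + f (T (k + 1)) - a := by
  have hlt : T k < T (k + 1) := hT.2.1 k.lt_succ_self
  obtain ⟨hR, hU, hL0, hL1⟩ := h.state_before_crossing hT hxy
    (fun s h0 h1 => hpos s h0 (h1.trans hlt.le)) hle
  have hRs := h.R_jump k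
  rw [max_zero_neg_sInf_image_eq_zero (fun u hu => by
    have := hpos u ((hT.nonneg k).trans hu.1) hu.2
    linarith)] at hRs
  have hLs := h.L_jump k
  have hUs := h.U_jump k
  rw [max_eq_left (by linarith)] at hLs
  rw [min_eq_right (by linarith)] at hUs
  refine ⟨?_, ?_, ?_⟩ <;> linarith

/-- There is no reflection at `0` before the first crossing. -/
lemma R_eq_zero_of_mem_cell (h : IsPCTriple a T f y U L R) (hT : IsTimeGrid T) (hxy : x ≤ y)
    {k : ℕ} {t : ℝ} (h1 : T k ≤ t) (h2 : t < T (k + 1))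
    (hpos : ∀ s, 0 ≤ s → s ≤ t → 0 ≤ x + f s)
    (hle : ∀ j, 1 ≤ j → j ≤ k → x + f (T j) ≤ a) : R t = 0 := by
  obtain ⟨hR, hU, hL0, hL1⟩ := h.state_before_crossing hT hxy
    (fun s h0 h => hpos s h0 (h.trans h1)) hle
  rcases h1.eq_or_lt with rfl | h1
  · exact hR
  · rw [h.R_seg k t h1 h2, hR, zero_add]
    refine max_zero_neg_sInf_image_eq_zero fun u hu => ?_
    have := hpos u ((hT.nonneg k).trans hu.1) hu.2
    linarith

/-- Two triples of the same path that coalesce at a grid time stay together at all later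
grid times. -/
lemma coalesce (h : IsPCTriple a T f x U L R) (h' : IsPCTriple a T f y U' L' R') {n k : ℕ}
    (hnk : n ≤ k) (hU : U' (T n) = U (T n)) (hR : R' (T n) = R (T n)) :
    U' (T k) = U (T k) ∧ R' (T k) = R (T k) ∧ L' (T k) - L (T k) = L' (T n) - L (T n) := by
  induction k, hnk using Nat.le_induction with
  | base => exact ⟨hU, hR, rfl⟩
  | succ k _ ih =>
    obtain ⟨ihU, ihR, ihL⟩ := ih
    have hR1 : R' (T (k + 1)) = R (T (k + 1)) := by
      rw [h.R_jump, h'.R_jump, ihU, ihR]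
    refine ⟨by rw [h.U_jump, h'.U_jump, ihU, ihR, hR1], hR1, ?_⟩
    rw [h.L_jump, h'.L_jump, ihU, ihR, hR1]
    linarith

end IsPCTriple

lemma nonneg_of_lt_tauMinus {f : ℝ → ℝ} {y s : ℝ} (hs : 0 ≤ s) (h : (s : EReal) < tauMinus f y) :
    0 ≤ y + f s := by
  by_contra! hc
  exact not_le.mpr h (sInf_le ⟨s, ⟨hs, hc⟩, rfl⟩)

lemma TPlus_le {a : ℝ} {T : ℕ → ℝ} {f : ℝ → ℝ} {y : ℝ} {k : ℕ} (hk : 1 ≤ k)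
    (h : a < y + f (T k)) : TPlus a T f y ≤ (T k : EReal) :=
  sInf_le (mem_image_of_mem _ ⟨k, hk, rfl, h⟩)

/-- A finite crossing time is attained at a first grid time. -/
lemma exists_first_crossing {a : ℝ} {T : ℕ → ℝ} (hT : IsTimeGrid T) {f : ℝ → ℝ} {y : ℝ}
    (h : TPlus a T f y ≠ ⊤) :
    ∃ n : ℕ, TPlus a T f y = (T (n + 1) : EReal) ∧ a < y + f (T (n + 1)) ∧
      ∀ j, 1 ≤ j → j ≤ n → y + f (T j) ≤ a := by
  classical
  have hex : ∃ n : ℕ, a < y + f (T (n + 1)) := by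
    by_contra! hc
    refine h (sInf_eq_top.mpr ?_)
    rintro _ ⟨_, ⟨k, hk, rfl, hlt⟩, rfl⟩
    obtain ⟨n, rfl⟩ := Nat.exists_eq_add_of_le' hk
    exact absurd hlt (not_lt.mpr (hc n))
  have hmin : ∀ j, 1 ≤ j → j ≤ Nat.find hex → y + f (T j) ≤ a := by
    intro j h1 h2
    obtain ⟨m, rfl⟩ := Nat.exists_eq_add_of_le' h1
    exact not_lt.mp (Nat.find_min hex (by omega))
  refine ⟨Nat.find hex, le_antisymm (TPlus_le (by omega) (Nat.find_spec hex)) ?_,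
    Nat.find_spec hex, hmin⟩
  refine le_sInf ?_
  rintro _ ⟨_, ⟨k, hk, rfl, hlt⟩, rfl⟩
  refine EReal.coe_le_coe_iff.mpr (hT.2.1.monotone ?_)
  by_contra! hc
  exact absurd hlt (not_lt.mpr (hmin k hk (by omega)))

/-- If `T_a^{(x),+} < τ_0^{(x),-}`, then `L⁽ˣ⁺ᵉ⁾ - L⁽ˣ⁾ = 0` on `[0, T_a^{(x+ε),+})`,
`L⁽ˣ⁺ᵉ⁾ - L⁽ˣ⁾ = ε` on `[T_a^{(x),+}, ∞)`, and `R⁽ˣ⁺ᵉ⁾ = R⁽ˣ⁾` on `[0, ∞)`. -/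
theorem stmt8
    (a : ℝ) (ha : 0 ≤ a) (T : ℕ → ℝ) (hT : IsTimeGrid T)
    (f : ℝ → ℝ) (hf : CadlagFun f) (hf0 : f 0 = 0)
    (hfT : ∀ k : ℕ, 1 ≤ k → ContinuousAt f (T k))
    (x ε : ℝ) (hx : 0 ≤ x) (hε : 0 < ε)
    (U L R Ue Le Re : ℝ → ℝ)
    (hx_triple : IsPCTriple a T f x U L R)
    (hxe_triple : IsPCTriple a T f (x + ε) Ue Le Re)
    (horder : TPlus a T f x < tauMinus f x) :
    (∀ t : ℝ, 0 ≤ t → (t : EReal) < TPlus a T f (x + ε) → Le t - L t = 0) ∧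
    (∀ t : ℝ, TPlus a T f x ≤ (t : EReal) → Le t - L t = ε) ∧
    (∀ t : ℝ, 0 ≤ t → Re t = R t) := by
  obtain ⟨n, hn, hgt, hle⟩ := exists_first_crossing hT horder.ne_top
  have hpos : ∀ s, 0 ≤ s → s ≤ T (n + 1) → 0 ≤ x + f s := fun s h0 h1 =>
    nonneg_of_lt_tauMinus h0 ((hn ▸ EReal.coe_le_coe_iff.mpr h1).trans_lt horder)
  have hxe : x ≤ x + ε := by linarith
  obtain ⟨hR, hU, hL⟩ := hx_triple.state_at_crossing hT le_rfl hpos hle hgt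
  obtain ⟨hRe, hUe, hLe⟩ := hxe_triple.state_at_crossing hT hxe hpos hle hgt
  refine ⟨fun t ht hlt => ?_, fun t ht => ?_, fun t ht => ?_⟩
  · obtain ⟨k, h1, h2⟩ := hT.exists_cell ht
    have hle' : ∀ j, 1 ≤ j → j ≤ k → x + ε + f (T j) ≤ a := by
      intro j hj hjk
      by_contra! hc
      exact absurd (hlt.trans_le (TPlus_le hj hc))
        (not_lt.mpr (EReal.coe_le_coe_iff.mpr ((hT.2.1.monotone hjk).trans h1)))
    have htn : t < T (n + 1) := EReal.coe_lt_coe_iff.mp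
      (hlt.trans_le (TPlus_le n.succ_pos (by linarith)))
    have hpos' : ∀ s, 0 ≤ s → s ≤ T k → 0 ≤ x + f s := fun s h0 h =>
      hpos s h0 ((h.trans h1).trans htn.le)
    obtain ⟨-, -, hl0, hl1⟩ := hx_triple.state_before_crossing hT le_rfl hpos'
      (fun j hj hjk => by linarith [hle' j hj hjk])
    obtain ⟨-, -, he0, he1⟩ := hxe_triple.state_before_crossing hT le_rfl
      (fun s h0 h => by linarith [hpos' s h0 h]) hle'
    rw [hx_triple.L_eq_of_mem_cell h1 h2, hxe_triple.L_eq_of_mem_cell h1 h2]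
    linarith
  · rw [hn, EReal.coe_le_coe_iff] at ht
    obtain ⟨k, h1, h2⟩ := hT.exists_cell ((hT.nonneg _).trans ht)
    have hnk : n + 1 ≤ k := Nat.lt_succ_iff.mp (hT.2.1.lt_iff_lt.mp (ht.trans_lt h2))
    obtain ⟨-, -, hd⟩ := hx_triple.coalesce hxe_triple hnk (hUe.trans hU.symm)
      (hRe.trans hR.symm)
    rw [hx_triple.L_eq_of_mem_cell h1 h2, hxe_triple.L_eq_of_mem_cell h1 h2, hd, hL, hLe]
    ring
  · obtain ⟨k, h1, h2⟩ := hT.exists_cell ht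
    rcases le_or_gt (n + 1) k with hnk | hnk
    · obtain ⟨hU', hR', -⟩ := hx_triple.coalesce hxe_triple hnk (hUe.trans hU.symm)
        (hRe.trans hR.symm)
      rcases h1.eq_or_lt with rfl | h1
      · exact hR'
      · rw [hx_triple.R_seg k t h1 h2, hxe_triple.R_seg k t h1 h2, hU', hR']
    · have htn : t ≤ T (n + 1) := h2.le.trans (hT.2.1.monotone hnk)
      have hpos' : ∀ s, 0 ≤ s → s ≤ t → 0 ≤ x + f s := fun s h0 h => hpos s h0 (h.trans htn)
      have hle' : ∀ j, 1 ≤ j → j ≤ k → x + f (T j) ≤ a := fun j hj hjk => hle j hj (by omega)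
      rw [hx_triple.R_eq_zero_of_mem_cell hT le_rfl h1 h2 hpos' hle',
        hxe_triple.R_eq_zero_of_mem_cell hT hxe h1 h2 hpos' hle']
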